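/- There exists an n-vertex graph G (for all sufficiently large n) such that every subset of 2^{2^{(log₂ log₂ n)^{1/2 + o(1)}}} vertices of G contains both a clique and an independent set of size log₂ n. -/

import Mathlib

open Filter

open Classical in
/-- Independence of events depending on disjoint sets of coordinates. -/
theorem LR_indep_two {E F : Type*} [Finite E] [Finite F] (S : Set E)
    (X Y : (E → F) → Prop)
    (hX : ∀ ω ω' : E → F, (∀ e, e ∉ S → ω e = ω' e) → X ω → X ω')
    (hY : ∀ ω ω' : E → F, (∀ e ∈ S, ω e = ω' e) → Y ω → Y ω') :
    {ω | X ω ∧ Y ω}.ncard * Nat.card (E → F) = {ω | X ω}.ncard * {ω | Y ω}.ncard := by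
  rw [← Set.ncard_univ (α := E → F), ← Set.ncard_prod, ← Set.ncard_prod]
  let sw : (E → F) × (E → F) → (E → F) × (E → F) := fun z =>
    ((fun e => if e ∈ S then z.2 e else z.1 e), (fun e => if e ∈ S then z.1 e else z.2 e))
  have hsw : ∀ z, sw (sw z) = z := by
    rintro ⟨x, y⟩
    ext e <;> by_cases he : e ∈ S <;> simp [sw, he]
  refine Set.ncard_congr (fun z _ => sw z) ?_ ?_ ?_
  · rintro ⟨x, y⟩ h
    simp only [Set.mem_prod, Set.mem_ofPred_eq, Set.mem_univ, and_true] at h ⊢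
    exact ⟨hX x _ (fun e he => by simp [sw, he]) h.1, hY x _ (fun e he => by simp [sw, he]) h.2⟩
  · intro x y _ _ h
    rw [← hsw x, h, hsw]
  · rintro ⟨x, y⟩ h
    refine ⟨sw (x, y), ?_, hsw _⟩
    simp only [Set.mem_prod, Set.mem_ofPred_eq, Set.mem_univ, and_true] at h ⊢
    exact ⟨hX x _ (fun e he => by simp [sw, he]) h.1, hY y _ (fun e he => by simp [sw, he]) h.2⟩

open Classical in
theorem LR_indep {E F ι : Type*} [Finite E] [Finite F] [Nonempty F] (S : ι → Set E)
    (X : ι → (E → F) → Prop) (a b : ℕ) (I : Finset ι)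
    (hdis : ∀ i ∈ I, ∀ j ∈ I, i ≠ j → Disjoint (S i) (S j))
    (hX : ∀ i ∈ I, ∀ ω ω' : E → F, (∀ e ∈ S i, ω e = ω' e) → X i ω → X i ω')
    (hc : ∀ i ∈ I, b * {ω | X i ω}.ncard ≤ a * Nat.card (E → F)) :
    b ^ I.card * {ω | ∀ i ∈ I, X i ω}.ncard ≤ a ^ I.card * Nat.card (E → F) := by
  induction I using Finset.induction_on with
  | empty => simp [Set.ncard_univ]
  | insert i I hi ih =>
    have ih' := ih (fun i hi j hj => hdis i (Finset.mem_insert_of_mem hi) j (Finset.mem_insert_of_mem hj))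
      (fun i hi => hX i (Finset.mem_insert_of_mem hi)) (fun i hi => hc i (Finset.mem_insert_of_mem hi))
    have h2 := LR_indep_two (S i) (fun ω => ∀ j ∈ I, X j ω) (X i)
      (by
        intro ω ω' h hx j hj
        refine hX j (Finset.mem_insert_of_mem hj) ω ω' (fun e he => h e ?_) (hx j hj)
        have := hdis j (Finset.mem_insert_of_mem hj) i (Finset.mem_insert_self _ _)
          (by rintro rfl; exact hi hj)
        exact Set.disjoint_left.1 this he)
      (hX i (Finset.mem_insert_self _ _))
    have hci := hc i (Finset.mem_insert_self _ _)
    have heq : {ω : E → F | ∀ j ∈ insert i I, X j ω} = {ω | (∀ j ∈ I, X j ω) ∧ X i ω} := by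
      ext ω
      simp [and_comm]
    rw [heq, Finset.card_insert_of_notMem hi]
    have hpos : 0 < Nat.card (E → F) := Nat.card_pos
    refine Nat.le_of_mul_le_mul_right ?_ hpos
    rw [mul_assoc, h2]
    calc _ = (b ^ I.card * {ω | ∀ i ∈ I, X i ω}.ncard) * (b * {ω | X i ω}.ncard) := by ring
      _ ≤ (a ^ I.card * Nat.card (E → F)) * (a * Nat.card (E → F)) :=
          Nat.mul_le_mul ih' hci
      _ = _ := by ring

/-- The non-degenerate pairs inside `B`. -/
def LRpairs {V : Type*} (B : Finset V) : Set (Sym2 V) := {e | ¬ e.IsDiag ∧ ∀ x ∈ e, x ∈ B}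

open Classical in
/-- Lines in the three dimensional affine space. -/
theorem LR_lines {V : Type*} [Fintype V] (p : ℕ) (hp : p.Prime) (A : Finset V) (hA : A.card = p ^ 3) :
    ∃ (ι : Type) (_ : Fintype ι) (B : ι → Finset V), Fintype.card ι = p ^ 4 ∧
      (∀ i, B i ⊆ A ∧ (B i).card = p) ∧ ∀ i j, i ≠ j → Disjoint (LRpairs (B i)) (LRpairs (B j)) := by
  have : Fact p.Prime := ⟨hp⟩
  have hc : Fintype.card (ZMod p × ZMod p × ZMod p) = Fintype.card A := by
    simp [ZMod.card, hA]; ring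
  let φ := Fintype.equivOfCardEq hc
  let g : (ZMod p × ZMod p) × (ZMod p × ZMod p) → ZMod p → V :=
    fun i x => (φ (x, i.1.1 * x + i.1.2, i.2.1 * x + i.2.2) : V)
  have hg : ∀ i j x y, g i x = g j y → x = y ∧ i.1.1 * x + i.1.2 = j.1.1 * y + j.1.2 ∧
      i.2.1 * x + i.2.2 = j.2.1 * y + j.2.2 := by
    intro i j x y h
    have := φ.injective (Subtype.ext h)
    simpa using this
  refine ⟨(ZMod p × ZMod p) × (ZMod p × ZMod p), inferInstance, fun i => Finset.univ.image (g i), ?_, ?_, ?_⟩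
  · simp [ZMod.card]; ring
  · intro i
    constructor
    · intro v hv
      obtain ⟨x, -, rfl⟩ := Finset.mem_image.1 hv
      exact (φ _).2
    · rw [Finset.card_image_of_injective, Finset.card_univ, ZMod.card]
      intro x y h
      exact (hg i i x y h).1
  · intro i j hij
    rw [Set.disjoint_left]
    rintro e ⟨hd, h1⟩ ⟨-, h2⟩
    induction e with
    | _ u v =>
      have hu := h1 u (by simp)
      have hv := h1 v (by simp)
      have hu' := h2 u (by simp)
      have hv' := h2 v (by simp)
      simp only [Finset.mem_image, Finset.mem_univ, true_and] at hu hv hu' hv'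
      obtain ⟨x, rfl⟩ := hu
      obtain ⟨y, rfl⟩ := hv
      obtain ⟨x', hx⟩ := hu'
      obtain ⟨y', hy⟩ := hv'
      obtain ⟨rfl, hx1, hx2⟩ := hg _ _ _ _ hx
      obtain ⟨rfl, hy1, hy2⟩ := hg _ _ _ _ hy
      have hne : x' - y' ≠ 0 := by
        intro h
        rw [sub_eq_zero] at h
        subst h
        exact hd (by simp)
      apply hij
      have e1 : i.1.1 = j.1.1 := mul_right_cancel₀ hne (by linear_combination hy1 - hx1)
      have e2 : i.2.1 = j.2.1 := mul_right_cancel₀ hne (by linear_combination hy2 - hx2)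
      have e3 : i.1.2 = j.1.2 := by rw [e1] at hx1; exact (add_left_cancel hx1).symm
      have e4 : i.2.2 = j.2.2 := by rw [e2] at hx2; exact (add_left_cancel hx2).symm
      exact Prod.ext (Prod.ext e1 e3) (Prod.ext e2 e4)

open Classical in
theorem LR_union {V : Type*} [Fintype V] (p Λ Q : ℕ) (hp : p.Prime) (hV : Fintype.card V ≤ 2 ^ Λ)
    (hΛ : Λ + 1 ≤ p) (hQ : 0 < Q) (Ev : Finset V → (Sym2 V → Fin Q) → Prop)
    (hdet : ∀ B : Finset V, B.card = p → ∀ ω ω' : Sym2 V → Fin Q,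
      (∀ e ∈ LRpairs B, ω e = ω' e) → Ev B ω → Ev B ω')
    (hc : ∀ B : Finset V, B.card = p →
      2 * {ω | ¬ Ev B ω}.ncard ≤ Nat.card (Sym2 V → Fin Q)) :
    4 * {ω | ¬ ∀ A : Finset V, p ^ 3 ≤ A.card →
      ∃ B ⊆ A, B.card = p ∧ Ev B ω}.ncard < Nat.card (Sym2 V → Fin Q) := by
  have : Nonempty (Fin Q) := ⟨⟨0, hQ⟩⟩
  have hpos : 0 < Nat.card (Sym2 V → Fin Q) := Nat.card_pos
  set Ω := Nat.card (Sym2 V → Fin Q) with hΩ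
  have hone : ∀ A ∈ (Finset.univ : Finset V).powersetCard (p ^ 3),
      2 ^ (p ^ 4) * {ω | ∀ B ⊆ A, B.card = p → ¬ Ev B ω}.ncard ≤ Ω := by
    intro A hA
    obtain ⟨ι, _, B, hι, hB, hdis⟩ := LR_lines p hp A (Finset.mem_powersetCard.1 hA).2
    have := LR_indep (E := Sym2 V) (F := Fin Q)
      (fun i => LRpairs (B i)) (fun i ω => ¬ Ev (B i) ω) 1 2
      (Finset.univ : Finset ι) (fun i _ j _ hij => hdis i j hij) ?_ ?_
    · rw [Finset.card_univ, hι, one_pow, one_mul] at this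
      refine le_trans (Nat.mul_le_mul_left _ (Set.ncard_le_ncard ?_ (Set.toFinite _))) this
      intro ω hω i _
      exact hω (B i) (hB i).1 (hB i).2
    · intro i _ ω ω' h hn hE
      exact hn (hdet (B i) (hB i).2 ω' ω (fun e he => (h e he).symm) hE)
    · intro i _
      rw [one_mul]
      exact hc (B i) (hB i).2
  set bad := {ω : Sym2 V → Fin Q | ¬ ∀ A : Finset V, p ^ 3 ≤ A.card →
      ∃ B ⊆ A, B.card = p ∧ Ev B ω} with hbad
  have hsub : bad ⊆ ⋃ A ∈ (Finset.univ : Finset V).powersetCard (p ^ 3),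
        {ω | ∀ B ⊆ A, B.card = p → ¬ Ev B ω} := by
    intro ω hω
    rw [hbad, Set.mem_ofPred_eq] at hω
    push Not at hω
    obtain ⟨A, hA, h⟩ := hω
    obtain ⟨A', hA', hc'⟩ := Finset.exists_subset_card_eq hA
    simp only [Set.mem_iUnion, Finset.mem_powersetCard]
    exact ⟨A', ⟨Finset.subset_univ _, hc'⟩, fun B hB => h B (hB.trans hA')⟩
  have hle := (Set.ncard_le_ncard hsub (Set.toFinite _)).trans (Finset.set_ncard_biUnion_le _ _)
  have htot : 2 ^ (p ^ 4) * bad.ncard ≤ 2 ^ (Λ * p ^ 3) * Ω := by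
    refine (Nat.mul_le_mul_left _ hle).trans ?_
    rw [Finset.mul_sum]
    refine (Finset.sum_le_card_nsmul _ _ _ hone).trans ?_
    rw [Finset.card_powersetCard, Finset.card_univ, smul_eq_mul]
    refine Nat.mul_le_mul_right _ ((Nat.choose_le_pow _ _).trans ?_)
    rw [pow_mul]
    exact Nat.pow_le_pow_left hV _
  have hexp : Λ * p ^ 3 + 2 < p ^ 4 := by
    have h3 : 2 ^ 3 ≤ p ^ 3 := Nat.pow_le_pow_left hp.two_le 3
    have : (Λ + 1) * p ^ 3 ≤ p * p ^ 3 := Nat.mul_le_mul_right _ hΛ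
    have h4 : p * p ^ 3 = p ^ 4 := by ring
    nlinarith
  have hexp2 : 4 * 2 ^ (Λ * p ^ 3) < 2 ^ (p ^ 4) := by
    have := Nat.pow_lt_pow_right (a := 2) (by norm_num) hexp
    rw [pow_add] at this
    omega
  by_contra hcon
  rw [not_lt] at hcon
  have h1 : 2 ^ (p ^ 4) * Ω ≤ 4 * 2 ^ (Λ * p ^ 3) * Ω := by
    calc _ ≤ 2 ^ (p ^ 4) * (4 * bad.ncard) := Nat.mul_le_mul_left _ hcon
      _ = 4 * (2 ^ (p ^ 4) * bad.ncard) := by ring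
      _ ≤ 4 * (2 ^ (Λ * p ^ 3) * Ω) := Nat.mul_le_mul_left _ htot
      _ = _ := by ring
  have := Nat.le_of_mul_le_mul_right h1 hpos
  omega


theorem LR_single {E F : Type*} [Finite E] [Finite F] (e : E) (c : F) :
    Nat.card F * {ω : E → F | ω e = c}.ncard = Nat.card (E → F) := by
  classical
  rw [← Set.ncard_univ (α := E → F), ← Set.ncard_univ (α := F), mul_comm, ← Set.ncard_prod]
  refine Set.ncard_congr (fun z _ => Function.update z.1 e z.2) ?_ ?_ ?_
  · intro z _
    trivial
  · rintro ⟨x, a⟩ ⟨y, b⟩ hx hy h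
    have hx' : x e = c := hx.1
    have hy' : y e = c := hy.1
    have hab : a = b := by simpa using congrFun h e
    have hxy : x = y := by
      funext e'
      by_cases he : e' = e
      · subst he; rw [hx', hy']
      · simpa [he] using congrFun h e'
    rw [hab, hxy]
  · intro ω _
    exact ⟨(Function.update ω e c, ω e), ⟨by simp, trivial⟩, by simp⟩

theorem LR_single_ne {E F : Type*} [Finite E] [Finite F] (e : E) (c : F) :
    Nat.card F * {ω : E → F | ω e ≠ c}.ncard = (Nat.card F - 1) * Nat.card (E → F) := by
  have h := LR_single e c
  have h2 := Set.ncard_add_ncard_compl {ω : E → F | ω e = c}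
  have h3 : {ω : E → F | ω e = c}ᶜ = {ω : E → F | ω e ≠ c} := rfl
  rw [h3] at h2
  rw [Nat.sub_mul, one_mul]
  nth_rewrite 1 [← h2]
  rw [Nat.mul_add, h]
  omega

theorem LR_bern (Q r : ℕ) (hQ : 1 ≤ Q) (hr : Q ≤ r) : 2 * (Q - 1) ^ r ≤ Q ^ r := by
  obtain ⟨q, rfl⟩ : ∃ q, Q = q + 1 := ⟨Q - 1, by omega⟩
  simp only [Nat.add_sub_cancel]
  have key : ∀ r, q ^ (r + 1) + (r + 1) * q ^ r ≤ (q + 1) ^ (r + 1) := by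
    intro r
    induction r with
    | zero => simp
    | succ r ih =>
      calc q ^ (r + 1 + 1) + (r + 1 + 1) * q ^ (r + 1)
          ≤ (q ^ (r + 1) + (r + 1) * q ^ r) * (q + 1) := by
            have : 0 ≤ (r + 1) * q ^ r := Nat.zero_le _
            calc _ = q * q ^ (r + 1) + q ^ (r + 1) + (r + 1) * q ^ r * q := by ring
              _ ≤ q * q ^ (r + 1) + q ^ (r + 1) + (r + 1) * q ^ r * q + (r + 1) * q ^ r := by omega
              _ = _ := by ring
        _ ≤ _ := by
            rw [pow_succ (q + 1) (r + 1)]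
            exact Nat.mul_le_mul_right _ ih
  obtain ⟨s, rfl⟩ : ∃ s, r = s + 1 := ⟨r - 1, by omega⟩
  refine le_trans ?_ (key s)
  have : q * q ^ s ≤ (s + 1) * q ^ s := Nat.mul_le_mul_right _ (by omega)
  have h2 : q ^ (s + 1) = q * q ^ s := by ring
  omega

theorem LR_edge {V : Type*} [Fintype V] (p Λ Q : ℕ) (hp : p.Prime) (hV : Fintype.card V ≤ 2 ^ Λ)
    (hΛ : Λ + 1 ≤ p) (hQ : 0 < Q) (hpQ : Q ≤ p.choose 2) (c : Fin Q) :
    4 * {ω : Sym2 V → Fin Q | ¬ ∀ A : Finset V, p ^ 3 ≤ A.card →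
      ∃ B ⊆ A, B.card = p ∧ ∃ u ∈ B, ∃ v ∈ B, u ≠ v ∧ ω s(u, v) = c}.ncard
      < Nat.card (Sym2 V → Fin Q) := by
  classical
  have : Nonempty (Fin Q) := ⟨⟨0, hQ⟩⟩
  refine LR_union p Λ Q hp hV hΛ hQ (fun B ω => ∃ u ∈ B, ∃ v ∈ B, u ≠ v ∧ ω s(u, v) = c) ?_ ?_
  · rintro B - ω ω' h ⟨u, hu, v, hv, huv, hc⟩
    refine ⟨u, hu, v, hv, huv, ?_⟩
    rw [← h, hc]
    exact ⟨by simpa using huv, by simp [hu, hv]⟩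
  · intro B hB
    have h := LR_indep (E := Sym2 V) (F := Fin Q) (fun e => {e}) (fun e ω => ω e ≠ c) (Q - 1) Q
      (B.offDiag.image Sym2.mk.uncurry)
      (fun i _ j _ hij => by simpa using hij)
      (fun i _ ω ω' h hi => by rw [← h i (Set.mem_singleton i)]; exact hi)
      (fun i _ => by have := LR_single_ne i c; simp only [Nat.card_fin] at this; exact this.le)
    have hcard : (B.offDiag.image Sym2.mk.uncurry).card = p.choose 2 := by
      rw [← hB]
      exact Sym2.card_image_offDiag B
    rw [hcard] at h
    have hb := LR_bern Q _ hQ hpQ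
    have hset : {ω : Sym2 V → Fin Q | ¬ ∃ u ∈ B, ∃ v ∈ B, u ≠ v ∧ ω s(u, v) = c} ⊆
        {ω | ∀ e ∈ B.offDiag.image Sym2.mk.uncurry, ω e ≠ c} := by
      intro ω hω e he hc
      obtain ⟨⟨u, v⟩, huv, rfl⟩ := Finset.mem_image.1 he
      rw [Finset.mem_offDiag] at huv
      exact hω ⟨u, huv.1, v, huv.2.1, huv.2.2, hc⟩
    have hle := Set.ncard_le_ncard hset (Set.toFinite _)
    refine Nat.le_of_mul_le_mul_left ?_ (pow_pos hQ (p.choose 2))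
    calc _ ≤ Q ^ (p.choose 2) * (2 * {ω : Sym2 V → Fin Q | ∀ e ∈ B.offDiag.image Sym2.mk.uncurry, ω e ≠ c}.ncard) := by
          gcongr
      _ = 2 * (Q ^ (p.choose 2) * {ω : Sym2 V → Fin Q | ∀ e ∈ B.offDiag.image Sym2.mk.uncurry, ω e ≠ c}.ncard) := by ring
      _ ≤ 2 * ((Q - 1) ^ (p.choose 2) * Nat.card (Sym2 V → Fin Q)) := Nat.mul_le_mul_left _ h
      _ = (2 * (Q - 1) ^ (p.choose 2)) * Nat.card (Sym2 V → Fin Q) := by ring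
      _ ≤ _ := Nat.mul_le_mul_right _ hb

theorem LR_keep {V : Type*} [Fintype V] (p Λ Q k : ℕ) (hp : p.Prime) (hV : Fintype.card V ≤ 2 ^ Λ)
    (hΛ : Λ + 1 ≤ p) (hQ : 0 < Q) (hkQ : 2 * (k * k) ≤ Q) (c : Fin Q) (P : Finset V → Prop)
    (hP : ∀ B : Finset V, B.card = p → ∃ K ⊆ B, K.card = k ∧ P K) :
    4 * {ω : Sym2 V → Fin Q | ¬ ∀ A : Finset V, p ^ 3 ≤ A.card →
      ∃ B ⊆ A, B.card = p ∧ ∃ K ⊆ B, K.card = k ∧ P K ∧ ∀ u ∈ K, ∀ v ∈ K, u ≠ v → ω s(u, v) ≠ c}.ncard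
      < Nat.card (Sym2 V → Fin Q) := by
  classical
  have : Nonempty (Fin Q) := ⟨⟨0, hQ⟩⟩
  refine LR_union p Λ Q hp hV hΛ hQ
    (fun B ω => ∃ K ⊆ B, K.card = k ∧ P K ∧ ∀ u ∈ K, ∀ v ∈ K, u ≠ v → ω s(u, v) ≠ c) ?_ ?_
  · rintro B - ω ω' h ⟨K, hK, hk, hPK, hne⟩
    refine ⟨K, hK, hk, hPK, fun u hu v hv huv => ?_⟩
    rw [← h]
    · exact hne u hu v hv huv
    · exact ⟨by simpa using huv, by simp [hK hu, hK hv]⟩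
  · intro B hB
    obtain ⟨K, hK, hk, hPK⟩ := hP B hB
    have hset : {ω : Sym2 V → Fin Q | ¬ ∃ K ⊆ B, K.card = k ∧ P K ∧
        ∀ u ∈ K, ∀ v ∈ K, u ≠ v → ω s(u, v) ≠ c} ⊆
        ⋃ z ∈ K ×ˢ K, {ω : Sym2 V → Fin Q | ω s(z.1, z.2) = c} := by
      intro ω hω
      by_contra hcon
      refine hω ⟨K, hK, hk, hPK, fun u hu v hv _ hc => hcon ?_⟩
      simp only [Set.mem_iUnion]
      exact ⟨(u, v), Finset.mk_mem_product hu hv, hc⟩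
    have hle := (Set.ncard_le_ncard hset (Set.toFinite _)).trans (Finset.set_ncard_biUnion_le _ _)
    refine Nat.le_of_mul_le_mul_left ?_ hQ
    have hsum : Q * ∑ z ∈ K ×ˢ K, {ω : Sym2 V → Fin Q | ω s(z.1, z.2) = c}.ncard
        = k * k * Nat.card (Sym2 V → Fin Q) := by
      rw [Finset.mul_sum, Finset.sum_congr rfl (fun z _ => ?_), Finset.sum_const, Finset.card_product, hk,
        smul_eq_mul]
      have := LR_single (E := Sym2 V) s(z.1, z.2) c
      rwa [Nat.card_fin] at this
    calc _ ≤ Q * (2 * ∑ z ∈ K ×ˢ K, {ω : Sym2 V → Fin Q | ω s(z.1, z.2) = c}.ncard) := by gcongr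
      _ = 2 * (Q * ∑ z ∈ K ×ˢ K, {ω : Sym2 V → Fin Q | ω s(z.1, z.2) = c}.ncard) := by ring
      _ = 2 * (k * k) * Nat.card (Sym2 V → Fin Q) := by rw [hsum]; ring
      _ ≤ _ := Nat.mul_le_mul_right _ hkQ

/-- `A` contains a clique of size at least `k`. -/
def LRHas {V : Type*} (G : SimpleGraph V) (A : Finset V) (k : ℕ) : Prop :=
  ∃ K ⊆ A, G.IsClique (K : Set V) ∧ k ≤ K.card

theorem LRHas.exact {V : Type*} {G : SimpleGraph V} {A : Finset V} {k : ℕ} (h : LRHas G A k) :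
    ∃ K ⊆ A, K.card = k ∧ G.IsClique (K : Set V) := by
  obtain ⟨K, hK, hc, hk⟩ := h
  obtain ⟨K', hK', hk'⟩ := Finset.exists_subset_card_eq hk
  exact ⟨K', hK'.trans hK, hk', hc.subset (by exact_mod_cast hK')⟩

theorem LRHas.mono {V : Type*} {G : SimpleGraph V} {A A' : Finset V} {k k' : ℕ} (h : LRHas G A k)
    (hA : A ⊆ A') (hk : k' ≤ k) : LRHas G A' k' := by
  obtain ⟨K, hK, hc, hk'⟩ := h
  exact ⟨K, hK.trans hA, hc, hk.trans hk'⟩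

theorem LR_pair {V : Type*} {G : SimpleGraph V} {A : Finset V} {u v : V} (hu : u ∈ A) (hv : v ∈ A)
    (h : G.Adj u v) : LRHas G A 2 := by
  classical
  refine ⟨{u, v}, ?_, ?_, ?_⟩
  · intro x hx
    simp only [Finset.mem_insert, Finset.mem_singleton] at hx
    rcases hx with rfl | rfl <;> assumption
  · intro x hx y hy hxy
    simp only [Finset.coe_insert, Finset.coe_singleton, Set.mem_insert_iff, Set.mem_singleton_iff] at hx hy
    rcases hx with rfl | rfl <;> rcases hy with rfl | rfl
    · exact absurd rfl hxy
    · exact h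
    · exact h.symm
    · exact absurd rfl hxy
  · rw [Finset.card_pair h.ne]

theorem LR_four {X : Type*} [Finite X] (P₁ P₂ P₃ P₄ : X → Prop)
    (h₁ : 4 * {x | ¬ P₁ x}.ncard < Nat.card X) (h₂ : 4 * {x | ¬ P₂ x}.ncard < Nat.card X)
    (h₃ : 4 * {x | ¬ P₃ x}.ncard < Nat.card X) (h₄ : 4 * {x | ¬ P₄ x}.ncard < Nat.card X) :
    ∃ x, P₁ x ∧ P₂ x ∧ P₃ x ∧ P₄ x := by
  by_contra hcon
  have hsub : (Set.univ : Set X) ⊆ ({x | ¬ P₁ x} ∪ {x | ¬ P₂ x}) ∪ ({x | ¬ P₃ x} ∪ {x | ¬ P₄ x}) := by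
    intro x _
    by_contra hx
    simp only [Set.mem_union, Set.mem_ofPred_eq, not_or, not_not] at hx
    exact hcon ⟨x, hx.1.1, hx.1.2, hx.2.1, hx.2.2⟩
  have h := Set.ncard_le_ncard hsub (Set.toFinite _)
  have a := Set.ncard_union_le ({x | ¬ P₁ x} ∪ {x | ¬ P₂ x}) ({x | ¬ P₃ x} ∪ {x | ¬ P₄ x})
  have b := Set.ncard_union_le {x | ¬ P₁ x} {x | ¬ P₂ x}
  have c := Set.ncard_union_le {x | ¬ P₃ x} {x | ¬ P₄ x}
  rw [Set.ncard_univ] at h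
  omega

theorem LR_noise {V : Type*} [Fintype V] (G : SimpleGraph V) (M k Λ p₁ p₂ : ℕ)
    (hG : ∀ A : Finset V, M ≤ A.card → LRHas G A k ∧ LRHas Gᶜ A k)
    (hk : 1 ≤ k) (hV : Fintype.card V ≤ 2 ^ Λ) (hp₁ : p₁.Prime) (hp₂ : p₂.Prime)
    (h₁ : Λ + 1 ≤ p₁) (h₂ : Λ + 1 ≤ p₂) (hk₁ : 2 * k + 1 ≤ p₁) (hM : M ≤ p₂) :
    ∃ G' : SimpleGraph V,
      (∀ A : Finset V, p₁ ^ 3 ≤ A.card → LRHas G' A 2 ∧ LRHas G'ᶜ A 2) ∧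
      (∀ A : Finset V, p₂ ^ 3 ≤ A.card → LRHas G' A k ∧ LRHas G'ᶜ A k) := by
  obtain ⟨Q, hQ⟩ : ∃ Q, Q = 2 * (k * k) := ⟨_, rfl⟩
  have hkk : 1 ≤ k * k := Nat.mul_pos hk hk
  have hQ2 : 2 ≤ Q := by omega
  have hQc : Q ≤ p₁.choose 2 := by
    calc Q ≤ (2 * k + 1).choose 2 := by
          rw [Nat.choose_two_right, hQ, Nat.le_div_iff_mul_le (by norm_num)]
          simp only [Nat.add_sub_cancel]
          nlinarith
      _ ≤ _ := Nat.choose_le_choose 2 hk₁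
  let c₀ : Fin Q := ⟨0, by omega⟩
  let c₁ : Fin Q := ⟨1, by omega⟩
  have hc : c₁ ≠ c₀ := by simp [c₀, c₁]
  have b1 := LR_edge (V := V) p₁ Λ Q hp₁ hV h₁ (by omega) hQc c₀
  have b2 := LR_edge (V := V) p₁ Λ Q hp₁ hV h₁ (by omega) hQc c₁
  have b3 := LR_keep (V := V) p₂ Λ Q k hp₂ hV h₂ (by omega) hQ.ge c₁ (fun K => G.IsClique (K : Set V))
    (fun B hB => (hG B (by omega)).1.exact)
  have b4 := LR_keep (V := V) p₂ Λ Q k hp₂ hV h₂ (by omega) hQ.ge c₀ (fun K => Gᶜ.IsClique (K : Set V))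
    (fun B hB => (hG B (by omega)).2.exact)
  obtain ⟨ω, g1, g2, g3, g4⟩ : ∃ ω : Sym2 V → Fin Q,
      (∀ A : Finset V, p₁ ^ 3 ≤ A.card →
        ∃ B ⊆ A, B.card = p₁ ∧ ∃ u ∈ B, ∃ v ∈ B, u ≠ v ∧ ω s(u, v) = c₀) ∧
      (∀ A : Finset V, p₁ ^ 3 ≤ A.card →
        ∃ B ⊆ A, B.card = p₁ ∧ ∃ u ∈ B, ∃ v ∈ B, u ≠ v ∧ ω s(u, v) = c₁) ∧
      (∀ A : Finset V, p₂ ^ 3 ≤ A.card → ∃ B ⊆ A, B.card = p₂ ∧ ∃ K ⊆ B, K.card = k ∧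
        G.IsClique (K : Set V) ∧ ∀ u ∈ K, ∀ v ∈ K, u ≠ v → ω s(u, v) ≠ c₁) ∧
      (∀ A : Finset V, p₂ ^ 3 ≤ A.card → ∃ B ⊆ A, B.card = p₂ ∧ ∃ K ⊆ B, K.card = k ∧
        Gᶜ.IsClique (K : Set V) ∧ ∀ u ∈ K, ∀ v ∈ K, u ≠ v → ω s(u, v) ≠ c₀) := by
    exact LR_four _ _ _ _ b1 b2 b3 b4
  refine ⟨SimpleGraph.mk (fun u v => u ≠ v ∧ (ω s(u, v) = c₀ ∨ (ω s(u, v) ≠ c₁ ∧ G.Adj u v)))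
    ⟨fun u v h => ?_⟩ ⟨fun u h => h.1 rfl⟩, ?_, ?_⟩
  · rw [Sym2.eq_swap, G.adj_comm] 
    exact ⟨h.1.symm, h.2⟩
  · intro A hA
    constructor
    · obtain ⟨B, hB, -, u, hu, v, hv, huv, h⟩ := g1 A hA
      exact LR_pair (hB hu) (hB hv) ⟨huv, Or.inl h⟩
    · obtain ⟨B, hB, -, u, hu, v, hv, huv, h⟩ := g2 A hA
      refine LR_pair (hB hu) (hB hv) ?_
      rw [SimpleGraph.compl_adj]
      refine ⟨huv, ?_⟩
      rintro ⟨-, h' | h'⟩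
      · exact hc (h.symm.trans h')
      · exact h'.1 h
  · intro A hA
    constructor
    · obtain ⟨B, hB, -, K, hK, hk, hcl, h⟩ := g3 A hA
      refine ⟨K, hK.trans hB, ?_, hk.ge⟩
      intro u hu v hv huv
      exact ⟨huv, Or.inr ⟨h u hu v hv huv, hcl hu hv huv⟩⟩
    · obtain ⟨B, hB, -, K, hK, hk, hcl, h⟩ := g4 A hA
      refine ⟨K, hK.trans hB, ?_, hk.ge⟩
      intro u hu v hv huv
      rw [SimpleGraph.compl_adj]
      refine ⟨huv, ?_⟩
      rintro ⟨-, h' | h'⟩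
      · exact h u hu v hv huv h'
      · exact ((SimpleGraph.compl_adj _ _ _).1 (hcl hu hv huv)).2 h'.2

/-- The lexicographic product. -/
def LRlex {V W : Type*} (G : SimpleGraph V) (H : SimpleGraph W) : SimpleGraph (V × W) where
  Adj x y := G.Adj x.1 y.1 ∨ (x.1 = y.1 ∧ H.Adj x.2 y.2)
  symm := ⟨fun _ _ h => h.elim (fun h => Or.inl h.symm) (fun h => Or.inr ⟨h.1.symm, h.2.symm⟩)⟩
  loopless := ⟨fun x h => h.elim (fun h => G.loopless.irrefl _ h) (fun h => H.loopless.irrefl _ h.2)⟩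

theorem LRlex_compl {V W : Type*} (G : SimpleGraph V) (H : SimpleGraph W) :
    (LRlex G H)ᶜ = LRlex Gᶜ Hᶜ := by
  ext ⟨a, b⟩ ⟨c, d⟩
  simp only [SimpleGraph.compl_adj, LRlex, ne_eq, Prod.mk.injEq]
  by_cases h : a = c
  · subst h
    simp
  · simp [h]

open Classical in
/-- The fibre of `A` over `c`. -/
noncomputable def LRfib {V W : Type*} (A : Finset (V × W)) (c : V) : Finset W :=
  (A.filter fun z => z.1 = c).image Prod.snd

theorem LRfib_mem {V W : Type*} (A : Finset (V × W)) (c : V) (w : W) :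
    w ∈ LRfib A c ↔ (c, w) ∈ A := by
  classical
  simp only [LRfib, Finset.mem_image, Finset.mem_filter]
  constructor
  · rintro ⟨⟨a, b⟩, ⟨h, rfl⟩, rfl⟩
    exact h
  · intro h
    exact ⟨(c, w), ⟨h, rfl⟩, rfl⟩

open Classical in
theorem LRfib_card {V W : Type*} (A : Finset (V × W)) :
    A.card = ∑ c ∈ A.image Prod.fst, (LRfib A c).card := by
  rw [Finset.card_eq_sum_card_image Prod.fst A]
  refine Finset.sum_congr rfl fun c _ => ?_
  rw [LRfib, Finset.card_image_of_injOn]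
  rintro ⟨a, b⟩ h ⟨a', b'⟩ h' hb
  simp only [Finset.coe_filter, Set.mem_ofPred_eq] at h h' hb
  rw [hb, h.2, h'.2]

theorem LR_lexclique {V W : Type*} (G : SimpleGraph V) (H : SimpleGraph W) (A : Finset (V × W))
    (K : Finset V) (hK : G.IsClique (K : Set V)) (r : ℕ) (h : ∀ c ∈ K, LRHas H (LRfib A c) r) :
    LRHas (LRlex G H) A (K.card * r) := by
  classical
  choose! L hL1 hL2 hL3 using h
  refine ⟨K.biUnion fun c => (L c).image (Prod.mk c), ?_, ?_, ?_⟩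
  · intro z hz
    simp only [Finset.mem_biUnion, Finset.mem_image] at hz
    obtain ⟨c, hc, w, hw, rfl⟩ := hz
    exact (LRfib_mem A c w).1 (hL1 c hc hw)
  · intro x hx y hy hxy
    simp only [Finset.mem_coe, Finset.mem_biUnion, Finset.mem_image] at hx hy
    obtain ⟨c, hc, w, hw, rfl⟩ := hx
    obtain ⟨c', hc', w', hw', rfl⟩ := hy
    by_cases hcc : c = c'
    · subst hcc
      refine Or.inr ⟨rfl, hL2 c hc hw hw' ?_⟩
      rintro rfl
      exact hxy rfl
    · exact Or.inl (hK hc hc' hcc)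
  · rw [Finset.card_biUnion]
    · rw [← smul_eq_mul]
      refine Finset.card_nsmul_le_sum _ _ _ fun c hc => ?_
      rw [Finset.card_image_of_injective _ (Prod.mk_right_injective c)]
      exact hL3 c hc
    · intro c _ c' _ hcc
      rw [Function.onFun, Finset.disjoint_left]
      intro z hz hz'
      obtain ⟨w, _, rfl⟩ := Finset.mem_image.1 hz
      obtain ⟨w', _, h⟩ := Finset.mem_image.1 hz'
      exact hcc (congrArg Prod.fst h).symm

theorem LR_lexstep {V W : Type*} (G : SimpleGraph V) (H : SimpleGraph W) (s m k ℓ : ℕ)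
    (hs0 : 1 ≤ s) (hm0 : 1 ≤ m)
    (hs : ∀ B : Finset V, s ≤ B.card → LRHas G B 2) (hm : ∀ B : Finset V, m ≤ B.card → LRHas G B k)
    (hH : ∀ t (A : Finset W), s ^ ℓ * m ^ t ≤ A.card → LRHas H A (min k (2 ^ t))) :
    ∀ t (A : Finset (V × W)), s ^ (ℓ + 1) * m ^ t ≤ A.card → LRHas (LRlex G H) A (min k (2 ^ t)) := by
  classical
  intro t A hA
  cases t with
  | zero =>
    have : A.Nonempty := by
      rw [← Finset.card_pos]
      have : 0 < s ^ (ℓ + 1) * m ^ 0 := by positivity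
      omega
    obtain ⟨x, hx⟩ := this
    exact ⟨{x}, by simpa using hx, by simp, by simp⟩
  | succ t =>
    by_cases hC : m ≤ (A.image Prod.fst).card
    · obtain ⟨K, hK, hKc, hk⟩ := hm _ hC
      have := LR_lexclique G H A K hKc 1 (fun c hc => by
        obtain ⟨⟨a, w⟩, hz, rfl⟩ := Finset.mem_image.1 (hK hc)
        exact ⟨{w}, by simpa [LRfib_mem] using hz, by simp, by simp⟩)
      exact this.mono subset_rfl (by rw [mul_one]; exact (min_le_left _ _).trans hk)
    · by_cases hh : s ≤ ((A.image Prod.fst).filter fun c => s ^ ℓ * m ^ t ≤ (LRfib A c).card).card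
      · obtain ⟨K, hK, hKc, hk⟩ := hs _ hh
        have := LR_lexclique G H A K hKc (min k (2 ^ t)) (fun c hc =>
          hH t _ (Finset.mem_filter.1 (hK hc)).2)
        refine this.mono subset_rfl ?_
        calc min k (2 ^ (t + 1)) ≤ 2 * min k (2 ^ t) := by rw [pow_succ]; omega
          _ ≤ _ := Nat.mul_le_mul_right _ hk
      · have hex : ∃ c, s ^ ℓ * m ^ (t + 1) ≤ (LRfib A c).card := by
          by_contra hcon
          push Not at hcon
          rw [LRfib_card, ← Finset.sum_filter_add_sum_filter_not (A.image Prod.fst)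
            (fun c => s ^ ℓ * m ^ t ≤ (LRfib A c).card)] at hA
          have e1 := Finset.sum_le_card_nsmul
            ((A.image Prod.fst).filter fun c => s ^ ℓ * m ^ t ≤ (LRfib A c).card)
            (fun c => (LRfib A c).card) (s ^ ℓ * m ^ (t + 1)) (fun c _ => (hcon c).le)
          have e2 := Finset.sum_le_card_nsmul
            ((A.image Prod.fst).filter fun c => ¬ s ^ ℓ * m ^ t ≤ (LRfib A c).card)
            (fun c => (LRfib A c).card) (s ^ ℓ * m ^ t) (fun c hc => by
              have := (Finset.mem_filter.1 hc).2
              omega)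
          have e3 := Finset.card_filter_le (A.image Prod.fst) (fun c => ¬ s ^ ℓ * m ^ t ≤ (LRfib A c).card)
          rw [smul_eq_mul] at e1 e2
          obtain ⟨m', rfl⟩ : ∃ m', m = m' + 1 := ⟨m - 1, by omega⟩
          obtain ⟨s', rfl⟩ : ∃ s', s = s' + 1 := ⟨s - 1, by omega⟩
          have e4 := e1.trans (Nat.mul_le_mul_right _ (by omega : _ ≤ s'))
          have e5 := e2.trans (Nat.mul_le_mul_right _ (by omega : _ ≤ m'))
          have hY : 0 < (s' + 1) ^ ℓ * (m' + 1) ^ t := by positivity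
          have h1 : (s' + 1) ^ (ℓ + 1) * (m' + 1) ^ (t + 1) =
            s' * ((s' + 1) ^ ℓ * (m' + 1) ^ (t + 1)) + (m' * ((s' + 1) ^ ℓ * (m' + 1) ^ t)
              + (s' + 1) ^ ℓ * (m' + 1) ^ t) := by ring
          omega
        obtain ⟨c, hc⟩ := hex
        have := LR_lexclique G H A {c} (by simp) (min k (2 ^ (t + 1))) (fun c' hc' => by
          rw [Finset.mem_singleton] at hc'
          subst hc'
          exact hH _ _ hc)
        simpa using this

theorem LR_comap {V W : Type*} (f : W ↪ V) (G : SimpleGraph V) (A : Finset W) (k : ℕ)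
    (h : LRHas G (A.map f) k) : LRHas (G.comap f) A k := by
  classical
  obtain ⟨K, hK, hc, hk⟩ := h
  refine ⟨A.filter fun x => f x ∈ K, Finset.filter_subset _ _, ?_, ?_⟩
  · intro x hx y hy hxy
    simp only [Finset.coe_filter, Set.mem_ofPred_eq] at hx hy
    exact hc hx.2 hy.2 (fun h => hxy (f.injective h))
  · refine hk.trans ?_
    rw [← Finset.card_map f]
    refine Finset.card_le_card fun x hx => ?_
    obtain ⟨y, hy, rfl⟩ := Finset.mem_map.1 (hK hx)
    exact Finset.mem_map_of_mem _ (Finset.mem_filter.2 ⟨hy, hx⟩)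

theorem LR_comap_compl {V W : Type*} (f : W ↪ V) (G : SimpleGraph V) :
    (G.comap f)ᶜ = Gᶜ.comap f := by
  ext x y
  simp [SimpleGraph.compl_adj]

/-- There is a graph on `N` vertices in which every `m` vertices contain both a clique and an
independent set of size `k`. -/
def LRGood (N m k : ℕ) : Prop :=
  ∃ G : SimpleGraph (Fin N), ∀ A : Finset (Fin N), m ≤ A.card → LRHas G A k ∧ LRHas Gᶜ A k

theorem LRGood.mono {N m k N' m' : ℕ} (h : LRGood N m k) (hN : N' ≤ N) (hm : m ≤ m') :
    LRGood N' m' k := by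
  obtain ⟨G, hG⟩ := h
  refine ⟨G.comap (Fin.castLEEmb hN), fun A hA => ?_⟩
  have := hG (A.map (Fin.castLEEmb hN)) (by rw [Finset.card_map]; omega)
  refine ⟨LR_comap _ _ _ _ this.1, ?_⟩
  rw [LR_comap_compl]
  exact LR_comap _ _ _ _ this.2

theorem LR_one {V : Type*} (G : SimpleGraph V) (A : Finset V) (k : ℕ) (h : 0 < A.card) :
    LRHas G A (min k (2 ^ 0)) := by
  obtain ⟨x, hx⟩ := Finset.card_pos.1 h
  exact ⟨{x}, by simpa using hx, by simp, by simp⟩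

theorem LR_power {N : ℕ} (G : SimpleGraph (Fin N)) (s m k : ℕ) (hs0 : 1 ≤ s) (hm0 : 2 ≤ m)
    (hs : ∀ B : Finset (Fin N), s ≤ B.card → LRHas G B 2 ∧ LRHas Gᶜ B 2)
    (hm : ∀ B : Finset (Fin N), m ≤ B.card → LRHas G B k ∧ LRHas Gᶜ B k) (ℓ : ℕ) :
    ∃ H : SimpleGraph (Fin (N ^ ℓ)), ∀ t (A : Finset (Fin (N ^ ℓ))), s ^ ℓ * m ^ t ≤ A.card →
      LRHas H A (min k (2 ^ t)) ∧ LRHas Hᶜ A (min k (2 ^ t)) := by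
  induction ℓ with
  | zero =>
    refine ⟨⊥, fun t A hA => ?_⟩
    have hc : A.card ≤ 1 := by simpa using Finset.card_le_univ A
    cases t with
    | zero =>
      have h0 : 0 < A.card := by
        rw [pow_zero, pow_zero] at hA
        omega
      exact ⟨LR_one _ _ _ h0, LR_one _ _ _ h0⟩
    | succ t =>
      exfalso
      have h1 : 1 ≤ m ^ t := Nat.one_le_pow _ _ (by omega)
      rw [pow_zero, one_mul, pow_succ] at hA
      nlinarith
  | succ ℓ ih =>
    obtain ⟨H, hH⟩ := ih
    let f : Fin (N ^ (ℓ + 1)) ↪ Fin N × Fin (N ^ ℓ) :=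
      ((finCongr (by ring)).trans finProdFinEquiv.symm).toEmbedding
    refine ⟨(LRlex G H).comap f, fun t A hA => ⟨?_, ?_⟩⟩
    · refine LR_comap _ _ _ _ (LR_lexstep G H s m k ℓ hs0 (by omega) (fun B hB => (hs B hB).1)
        (fun B hB => (hm B hB).1) (fun t A hA => (hH t A hA).1) t _ ?_)
      rwa [Finset.card_map]
    · rw [LR_comap_compl, LRlex_compl]
      refine LR_comap _ _ _ _ (LR_lexstep Gᶜ Hᶜ s m k ℓ hs0 (by omega) (fun B hB => (hs B hB).2)
        (fun B hB => (hm B hB).2) (fun t A hA => (hH t A hA).2) t _ ?_)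
      rwa [Finset.card_map]

theorem LR_step {N M k t : ℕ} (h : LRGood N M k) (hk : 1 ≤ k) (hkM : 2 * k ≤ M)
    (hN : N ≤ 2 ^ (k - 1)) (hkt : k ≤ 2 ^ t) (ℓ : ℕ) :
    LRGood (N ^ ℓ) (((4 * k) ^ 3) ^ ℓ * ((2 * M) ^ 3) ^ t) k := by
  obtain ⟨G, hG⟩ := h
  obtain ⟨p₁, hp₁, h1, h1'⟩ := Nat.exists_prime_lt_and_le_two_mul (2 * k) (by omega)
  obtain ⟨p₂, hp₂, h2, h2'⟩ := Nat.exists_prime_lt_and_le_two_mul M (by omega)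
  obtain ⟨G', hs, hm⟩ := LR_noise G M k (k - 1) p₁ p₂ hG hk (by simpa using hN) hp₁ hp₂ (by omega)
    (by omega) (by omega) (by omega)
  obtain ⟨H, hH⟩ := LR_power G' (p₁ ^ 3) (p₂ ^ 3) k (Nat.one_le_pow _ _ hp₁.pos)
    (hp₂.two_le.trans (Nat.le_self_pow (by norm_num) _)) hs hm ℓ
  refine ⟨H, fun A hA => ?_⟩
  have := hH t A (le_trans ?_ hA)
  · rwa [min_eq_left hkt] at this
  · gcongr
    omega

theorem LR_main (t : ℕ) (ht : 1 ≤ t) (a : ℕ) : ∀ N : ℕ, N ≤ 2 ^ (2 ^ t - 1) →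
    N ≤ 2 ^ ((16 * t) ^ ((a + 1).choose 2)) → LRGood N (2 ^ ((16 * t) ^ (a + 1))) (2 ^ t) := by
  induction a with
  | zero =>
    intro N _ hN
    simp only [zero_add, Nat.choose_succ_self, pow_zero, pow_one] at hN ⊢
    refine ⟨⊥, fun A hA => ?_⟩
    exfalso
    have h1 : A.card ≤ N := by simpa using Finset.card_le_univ A
    have h2 : 2 ^ 2 ≤ 2 ^ (16 * t) := Nat.pow_le_pow_right (by norm_num) (by omega)
    omega
  | succ a ih =>
    intro N hN1 hN2
    set b := 16 * t with hb
    set F := b ^ (a + 1) with hF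
    have hF1 : b ≤ F := Nat.le_self_pow (by omega) _
    have hg := ih (min (2 ^ (2 ^ t - 1)) (2 ^ (b ^ ((a + 1).choose 2)))) (min_le_left _ _) (min_le_right _ _)
    have hs := LR_step hg (Nat.one_le_two_pow) (by
      rw [← pow_succ']
      exact Nat.pow_le_pow_right (by norm_num) (by omega)) (min_le_left _ _) le_rfl F
    refine hs.mono ?_ ?_
    · rcases min_choice (2 ^ (2 ^ t - 1)) (2 ^ (b ^ ((a + 1).choose 2))) with h | h
      · rw [h]
        exact hN1.trans (Nat.le_self_pow (by omega) _)
      · rw [h, ← pow_mul, hF, ← pow_add]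
        refine hN2.trans (le_of_eq ?_)
        congr 2
        rw [Nat.choose_succ_succ' (a + 1) 1]
        simp [add_comm]
    · have e1 : (4 * 2 ^ t : ℕ) = 2 ^ (t + 2) := by ring
      have e2 : (2 * 2 ^ F : ℕ) = 2 ^ (F + 1) := by ring
      rw [e1, e2, ← pow_mul, ← pow_mul, ← pow_mul, ← pow_mul, ← pow_add]
      refine Nat.pow_le_pow_right (by norm_num) ?_
      rw [pow_succ b (a + 1), ← hF]
      have : t ≤ t * F := Nat.le_mul_of_pos_right _ (by omega)
      have h3 : F ≤ t * F := Nat.le_mul_of_pos_left _ (by omega)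
      calc (t + 2) * (3 * F) + (F + 1) * (3 * t) = 6 * (t * F) + 6 * F + 3 * t := by ring
        _ ≤ 16 * (t * F) := by omega
        _ = F * b := by rw [hb]; ring

theorem LR_fin (x : ℝ) (hx : 20 ≤ x) (hl : 16 ≤ Real.log x) :
    ((16 * (⌈x⌉₊ + 1 : ℕ) : ℕ) : ℝ) ^ (⌈√(2 * x)⌉₊ + 1) ≤
      (2 : ℝ) ^ (x ^ ((1 : ℝ) / 2 + 2 * Real.log (Real.log x) / Real.log x)) := by
  have hx0 : 0 < x := by linarith
  have hB : ((16 * (⌈x⌉₊ + 1 : ℕ) : ℕ) : ℝ) ≤ x ^ 2 := by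
    have := Nat.ceil_lt_add_one hx0.le
    push_cast
    nlinarith
  have hpow : x ^ ((1 : ℝ) / 2 + 2 * Real.log (Real.log x) / Real.log x) =
      √x * Real.log x ^ 2 := by
    rw [Real.rpow_add hx0, ← Real.sqrt_eq_rpow]
    congr 1
    rw [Real.rpow_def_of_pos hx0]
    have : Real.log x * (2 * Real.log (Real.log x) / Real.log x) =
        Real.log (Real.log x) + Real.log (Real.log x) := by
      field_simp
      ring
    rw [this, Real.exp_add, Real.exp_log (by linarith)]
    ring
  have ha : ((⌈√(2 * x)⌉₊ + 1 : ℕ) : ℝ) ≤ 4 * √x := by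
    have h1 := Nat.ceil_lt_add_one (Real.sqrt_nonneg (2 * x))
    have h2 : 1 ≤ √x := Real.one_le_sqrt.2 (by linarith)
    have h3 : √(2 * x) ≤ 2 * √x := by
      rw [Real.sqrt_le_left (by positivity), mul_pow, Real.sq_sqrt hx0.le]
      linarith
    push_cast
    linarith
  have hl2 : (1 : ℝ) / 2 ≤ Real.log 2 := by
    have := Real.log_two_gt_d9
    linarith
  rw [hpow]
  calc ((16 * (⌈x⌉₊ + 1 : ℕ) : ℕ) : ℝ) ^ (⌈√(2 * x)⌉₊ + 1) ≤ (x ^ 2) ^ (⌈√(2 * x)⌉₊ + 1) :=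
        pow_le_pow_left₀ (by positivity) hB _
    _ = Real.exp (Real.log x * (2 * (⌈√(2 * x)⌉₊ + 1 : ℕ))) := by
        rw [← Real.rpow_def_of_pos hx0, ← pow_mul, ← Real.rpow_natCast]
        push_cast
        rfl
    _ ≤ Real.exp (Real.log 2 * (√x * Real.log x ^ 2)) := by
        apply Real.exp_le_exp.2
        have hs : 0 < √x := Real.sqrt_pos.2 hx0
        calc Real.log x * (2 * (⌈√(2 * x)⌉₊ + 1 : ℕ)) ≤ Real.log x * (2 * (4 * √x)) := by gcongr
          _ = (1 / 2) * (√x * (Real.log x * 16)) := by ring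
          _ ≤ (1 / 2) * (√x * (Real.log x * Real.log x)) := by gcongr
          _ ≤ Real.log 2 * (√x * Real.log x ^ 2) := by rw [← sq]; gcongr
    _ = _ := by rw [Real.rpow_def_of_pos (by norm_num : (0 : ℝ) < 2)]

theorem LR_nat_le (n : ℕ) (y : ℕ) (hn : 0 < n) (h : Real.logb 2 n ≤ y) : n ≤ 2 ^ y := by
  have h1 : (n : ℝ) ≤ (2 : ℝ) ^ (y : ℝ) :=
    (Real.logb_le_iff_le_rpow (by norm_num) (by exact_mod_cast hn)).1 h
  rw [Real.rpow_natCast] at h1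
  exact_mod_cast h1

/-- Theorem 1.1: there is a function `f = o(1)` such that for all sufficiently large
`n` there is an `n`-vertex graph in which every subset of
`2^{2^{(log₂ log₂ n)^{1/2 + f n}}}` vertices contains both a clique and an independent
set of size `log₂ n`. -/
theorem locally_ramsey_log_n :
    ∃ f : ℕ → ℝ, Tendsto f atTop (nhds 0) ∧
      ∀ᶠ n : ℕ in atTop, ∃ G : SimpleGraph (Fin n),
        ∀ A : Finset (Fin n),
          (2 : ℝ) ^ ((2 : ℝ) ^ ((Real.logb 2 (Real.logb 2 n)) ^ ((1 : ℝ) / 2 + f n)))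
            ≤ (A.card : ℝ) →
          (∃ K ⊆ A, G.IsClique (K : Set (Fin n)) ∧ Real.logb 2 n ≤ (K.card : ℝ)) ∧
          (∃ K ⊆ A, (Gᶜ).IsClique (K : Set (Fin n)) ∧ Real.logb 2 n ≤ (K.card : ℝ)) := by
  have hL : Tendsto (fun n : ℕ => Real.logb 2 (n : ℝ)) atTop atTop :=
    (Real.tendsto_logb_atTop (by norm_num)).comp tendsto_natCast_atTop_atTop
  have hX : Tendsto (fun n : ℕ => Real.logb 2 (Real.logb 2 (n : ℝ))) atTop atTop :=
    (Real.tendsto_logb_atTop (by norm_num)).comp hL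
  have hLX : Tendsto (fun n : ℕ => Real.log (Real.logb 2 (Real.logb 2 (n : ℝ)))) atTop atTop :=
    Real.tendsto_log_atTop.comp hX
  refine ⟨fun n => 2 * Real.log (Real.log (Real.logb 2 (Real.logb 2 (n : ℝ)))) /
    Real.log (Real.logb 2 (Real.logb 2 (n : ℝ))), ?_, ?_⟩
  · have h0 : Tendsto (fun y : ℝ => Real.log y / y) atTop (nhds 0) := by
      have := Real.isLittleO_log_id_atTop.tendsto_div_nhds_zero
      simpa using this
    have := (h0.comp hLX).const_mul 2
    simpa [Function.comp_def, mul_div_assoc] using this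
  · filter_upwards [hX.eventually_ge_atTop 20, hLX.eventually_ge_atTop 16,
      hL.eventually_ge_atTop 1, eventually_gt_atTop 0] with n hx hl hL1 hn
    have hfin := LR_fin _ hx hl
    set x := Real.logb 2 (Real.logb 2 (n : ℝ)) with hxdef
    have hLx : Real.logb 2 (n : ℝ) = (2 : ℝ) ^ x :=
      (Real.rpow_logb (by norm_num) (by norm_num) (by linarith)).symm
    have hceil : x ≤ ⌈x⌉₊ := Nat.le_ceil x
    have hLt : Real.logb 2 (n : ℝ) ≤ (2 : ℝ) ^ ⌈x⌉₊ := by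
      rw [hLx, ← Real.rpow_natCast]
      exact Real.rpow_le_rpow_of_exponent_le (by norm_num) hceil
    have hLt2 : Real.logb 2 (n : ℝ) ≤ ((2 ^ (⌈x⌉₊ + 1) : ℕ) : ℝ) := by
      push_cast
      rw [pow_succ]
      linarith
    have hN1 : n ≤ 2 ^ (2 ^ (⌈x⌉₊ + 1) - 1) := by
      apply LR_nat_le n _ hn
      refine hLt.trans ?_
      have : 2 ^ ⌈x⌉₊ ≤ 2 ^ (⌈x⌉₊ + 1) - 1 := by
        have := Nat.one_le_two_pow (n := ⌈x⌉₊)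
        rw [pow_succ]
        omega
      exact_mod_cast this
    have hN2 : n ≤ 2 ^ ((16 * (⌈x⌉₊ + 1)) ^ ((⌈√(2 * x)⌉₊ + 1).choose 2)) := by
      apply LR_nat_le n _ hn
      have hc : x ≤ ((⌈√(2 * x)⌉₊ + 1).choose 2 : ℕ) := by
        rw [Nat.cast_choose_two]
        have h1 : √(2 * x) ≤ ⌈√(2 * x)⌉₊ := Nat.le_ceil _
        have h2 : √(2 * x) ^ 2 = 2 * x := Real.sq_sqrt (by linarith)
        have h3 := Real.sqrt_nonneg (2 * x)
        push_cast
        nlinarith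
      rw [hLx]
      calc (2 : ℝ) ^ x ≤ (2 : ℝ) ^ (((⌈√(2 * x)⌉₊ + 1).choose 2 : ℕ) : ℝ) :=
            Real.rpow_le_rpow_of_exponent_le (by norm_num) hc
        _ = (2 : ℝ) ^ ((⌈√(2 * x)⌉₊ + 1).choose 2) := Real.rpow_natCast _ _
        _ ≤ (((16 * (⌈x⌉₊ + 1)) ^ ((⌈√(2 * x)⌉₊ + 1).choose 2) : ℕ) : ℝ) := by
            have : 2 ^ ((⌈√(2 * x)⌉₊ + 1).choose 2) ≤
                (16 * (⌈x⌉₊ + 1)) ^ ((⌈√(2 * x)⌉₊ + 1).choose 2) :=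
              Nat.pow_le_pow_left (by omega) _
            exact_mod_cast this
    obtain ⟨G, hG⟩ := LR_main (⌈x⌉₊ + 1) (by omega) ⌈√(2 * x)⌉₊ n hN1 hN2
    refine ⟨G, fun A hA => ?_⟩
    have hcard : 2 ^ ((16 * (⌈x⌉₊ + 1)) ^ (⌈√(2 * x)⌉₊ + 1)) ≤ A.card := by
      have h1 : ((2 ^ ((16 * (⌈x⌉₊ + 1)) ^ (⌈√(2 * x)⌉₊ + 1)) : ℕ) : ℝ) ≤ A.card := by
        refine le_trans ?_ hA
        rw [Nat.cast_pow, ← Real.rpow_natCast, Nat.cast_pow]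
        exact Real.rpow_le_rpow_of_exponent_le (by norm_num) hfin
      exact_mod_cast h1
    obtain ⟨⟨K, hK, hKc, hk⟩, ⟨K', hK', hKc', hk'⟩⟩ := hG A hcard
    exact ⟨⟨K, hK, hKc, hLt2.trans (by exact_mod_cast hk)⟩,
      ⟨K', hK', hKc', hLt2.trans (by exact_mod_cast hk')⟩⟩
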